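/- arXiv:2506.06116 — 2 statements merged into one kernel-verified Lean document; each statement's English description precedes it below -/
import Mathlib

section
/- Let (A, 𝔪_A) be a regular local ring, let (B, 𝔪_B) be a Noetherian Cohen–Macaulay local ring, and let φ : A → B be a flat local ring homomorphism. Let M be a nonzero finitely generated B-module which is maximal Cohen–Macaulay (i.e. depth_B M = dim B). Then M is flat as an A-module via φ. -/
open IsLocalRing RingTheory.Sequence

/-- The depth of a module `M` over a local ring `B`: the supremum of lengths of
`M`-regular sequences contained in the maximal ideal of `B`. -/
noncomputable def moduleDepth (B : Type*) [CommRing B] [IsLocalRing B]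
    (M : Type*) [AddCommGroup M] [Module B M] : ℕ∞ :=
  sSup {n : ℕ∞ | ∃ rs : List B, (rs.length : ℕ∞) = n ∧
    (∀ y ∈ rs, y ∈ maximalIdeal B) ∧ RingTheory.Sequence.IsRegular M rs}

/-- A local ring is Cohen–Macaulay if its depth (as a module over itself) equals
its Krull dimension. -/
def IsCohenMacaulayLocal (B : Type*) [CommRing B] [IsLocalRing B] : Prop :=
  ((moduleDepth B B : ℕ∞) : WithBot ℕ∞) = ringKrullDim B

/-- A module `M` over a local ring `B` is maximal Cohen–Macaulay if
`depth_B M = dim B`. -/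
def IsMaximalCohenMacaulay (B : Type*) [CommRing B] [IsLocalRing B]
    (M : Type*) [AddCommGroup M] [Module B M] : Prop :=
  ((moduleDepth B M : ℕ∞) : WithBot ℕ∞) = ringKrullDim B

/-- A Noetherian local ring is regular if its maximal ideal can be generated by
`dim A` elements. -/
def IsRegularLocal (A : Type*) [CommRing A] [IsLocalRing A] : Prop :=
  ∃ s : Finset A, Ideal.span (s : Set A) = maximalIdeal A ∧
    ((s.card : ℕ∞) : WithBot ℕ∞) = ringKrullDim A

section Flatness

universe u

open TensorProduct Pointwise

lemma LinearMap.rTensor_injective_of_flat_baseChange {A M R L P : Type*} [CommRing A] [CommRing R]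
    [Algebra A R] [AddCommGroup M] [Module A M] [AddCommGroup L] [AddCommGroup P] [Module A L]
    [Module A P] [Module R L] [Module R P] [IsScalarTower A R L] [IsScalarTower A R P]
    [Module.Flat R (R ⊗[A] M)] (f : L →ₗ[A] P) (hf : Function.Injective f)
    (hR : Function.Surjective (algebraMap A R)) :
    Function.Injective (f.rTensor M) := by
  let g : L →ₗ[R] P := LinearMap.extendScalarsOfSurjective hR f
  have h := Module.Flat.rTensor_preserves_injective_linearMap (M := R ⊗[A] M) g hf
  let eL := AlgebraTensorModule.cancelBaseChange A R R L M |>.restrictScalars A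
  let eP := AlgebraTensorModule.cancelBaseChange A R R P M |>.restrictScalars A
  have key : f.rTensor M ∘ₗ eL.toLinearMap =
      eP.toLinearMap ∘ₗ (g.rTensor (R ⊗[A] M)).restrictScalars A := by
    apply LinearMap.ext
    intro t
    induction t using TensorProduct.induction_on with
    | zero => simp
    | add a b ha hb => simpa using congrArg₂ (· + ·) ha hb
    | tmul l s =>
      induction s using TensorProduct.induction_on with
      | zero => simp
      | add a b ha hb => simpa [TensorProduct.tmul_add] using congrArg₂ (· + ·) ha hb
      | tmul r m =>
        simp only [LinearMap.comp_apply, LinearMap.coe_restrictScalars, LinearEquiv.coe_coe,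
          LinearMap.rTensor_tmul, eL, eP, LinearEquiv.restrictScalars_apply,
          AlgebraTensorModule.cancelBaseChange_tmul]
        rw [← map_smul g]; rfl
  have h2 : Function.Injective (f.rTensor M ∘ₗ eL.toLinearMap) := by
    rw [key]
    exact eP.injective.comp h
  rw [LinearMap.coe_comp] at h2
  exact h2.of_comp_right eL.surjective

lemma exists_rTensor_eq_of_rTensor_eq_zero {A M L P Q : Type*} [CommRing A]
    [AddCommGroup M] [Module A M] [AddCommGroup L] [AddCommGroup P] [AddCommGroup Q] [Module A L]
    [Module A P] [Module A Q] {x : A}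
    [Module.Flat (A ⧸ Ideal.span {x}) ((A ⧸ Ideal.span {x}) ⊗[A] M)]
    (f : L →ₗ[A] P) (g : Q →ₗ[A] L) (h : Q →ₗ[A] P) (hfg : f ∘ₗ g = x • h)
    (hg : LinearMap.range g = (x • (⊤ : Submodule A P)).comap f)
    (hx : IsSMulRegular (P ⊗[A] M) x) {t : L ⊗[A] M} (ht : f.rTensor M t = 0) :
    ∃ u, g.rTensor M u = t ∧ h.rTensor M u = 0 := by
  let N := LinearMap.range g
  let fbar : (L ⧸ N) →ₗ[A] QuotSMulTop x P := N.mapQ _ f hg.le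
  have hinj : Function.Injective fbar := by
    rw [← LinearMap.ker_eq_bot]
    simp only [fbar, Submodule.mapQ, N]
    rw [Submodule.ker_liftQ_eq_bot]
    intro z hz
    rw [LinearMap.mem_ker, LinearMap.comp_apply, Submodule.mkQ_apply,
      Submodule.Quotient.mk_eq_zero] at hz
    rw [hg]
    exact hz
  have htors : Module.IsTorsionBySet A (L ⧸ N) (Ideal.span {x} : Ideal A) := by
    rw [Module.isTorsionBySet_iff_subset_annihilator]
    refine (Ideal.span_singleton_le_iff_mem (Module.annihilator A (L ⧸ N))).2 ?_
    rw [Module.mem_annihilator]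
    intro z
    apply hinj
    rw [map_smul, map_zero]
    obtain ⟨y, hy⟩ := Submodule.Quotient.mk_surjective _ (fbar z)
    rw [← hy, ← Submodule.Quotient.mk_smul, Submodule.Quotient.mk_eq_zero]
    exact Submodule.smul_mem_pointwise_smul _ _ _ trivial
  let := htors.module
  have : IsScalarTower A (A ⧸ Ideal.span {x}) (L ⧸ N) := htors.isScalarTower
  have hinj' := LinearMap.rTensor_injective_of_flat_baseChange (M := M)
    (R := A ⧸ Ideal.span {x}) fbar hinj Ideal.Quotient.mk_surjective
  have hzero : N.mkQ.rTensor M t = 0 := by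
    apply hinj'
    have hc : fbar ∘ₗ N.mkQ = (x • (⊤ : Submodule A P)).mkQ ∘ₗ f := by
      ext; rfl
    rw [map_zero, ← LinearMap.comp_apply, ← LinearMap.rTensor_comp, hc, LinearMap.rTensor_comp,
      LinearMap.comp_apply, ht, map_zero]
  have hex : Function.Exact g N.mkQ := by
    rw [LinearMap.exact_iff, Submodule.ker_mkQ]
  obtain ⟨u, hu⟩ := ((rTensor_exact M hex N.mkQ_surjective) t).1 hzero
  refine ⟨u, hu, hx ?_⟩
  dsimp only
  rw [smul_zero, ← LinearMap.smul_apply, ← LinearMap.rTensor_smul, ← hfg, LinearMap.rTensor_comp,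
    LinearMap.comp_apply, hu, ht]

/-- For every finite module `N`, no nonzero element of `N ⊗ M` lies in a set `S` each of whose
elements is `x` times an element of `S`. -/
def IsTensorSeparated (A : Type u) [CommRing A] (M : Type*) [AddCommGroup M] [Module A M]
    (x : A) : Prop :=
  ∀ (N : Type u) [AddCommGroup N] [Module A N] [Module.Finite A N] (S : Set (N ⊗[A] M)),
    (∀ t ∈ S, ∃ u ∈ S, x • u = t) → ∀ t ∈ S, t = 0

lemma Module.Flat.of_isSMulRegular_of_flat_quotient {A M : Type*} [CommRing A] [IsNoetherianRing A]
    [AddCommGroup M] [Module A M] {x : A} (hx : IsSMulRegular M x)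
    [Module.Flat (A ⧸ Ideal.span {x}) ((A ⧸ Ideal.span {x}) ⊗[A] M)]
    (hsep : IsTensorSeparated A M x) : Module.Flat A M := by
  rw [Module.Flat.iff_rTensor_injective']
  have hxA : IsSMulRegular (A ⊗[A] M) x := (TensorProduct.lid A M).isSMulRegular_congr x |>.2 hx
  intro I
  induction I using IsNoetherian.induction with
  | _ I ih =>
  let J : Ideal A := I.comap (LinearMap.lsmul A A x)
  have hIJ : I ≤ J := fun a ha ↦ I.smul_mem x ha
  rcases hIJ.lt_or_eq with hlt | heq
  · have hJ := ih J hlt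
    have hxJ : IsSMulRegular (J ⊗[A] M) x :=
      hxA.of_injective _ hJ
    rw [← LinearMap.ker_eq_bot, LinearMap.ker_eq_bot']
    intro t ht
    let g : J →ₗ[A] I := ((LinearMap.lsmul A A x) ∘ₗ J.subtype).codRestrict I fun y ↦ y.2
    obtain ⟨u, rfl, hu⟩ := exists_rTensor_eq_of_rTensor_eq_zero (M := M) (x := x)
      (Submodule.inclusion hIJ) g LinearMap.id (by ext; rfl)
      (by
        ext y
        simp only [LinearMap.mem_range, Submodule.mem_comap, Submodule.mem_smul_pointwise_iff_exists]
        constructor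
        · rintro ⟨z, rfl⟩
          exact ⟨z, trivial, rfl⟩
        · rintro ⟨z, -, hz⟩
          refine ⟨z, Subtype.ext ?_⟩
          have hz' := congrArg Subtype.val hz
          exact hz')
      hxJ (t := t) (by
        apply hJ
        rw [map_zero, ← LinearMap.comp_apply, ← LinearMap.rTensor_comp]
        exact ht)
    rw [LinearMap.rTensor_id, LinearMap.id_apply] at hu
    rw [hu, map_zero]
  · rw [← LinearMap.ker_eq_bot, LinearMap.ker_eq_bot']
    refine hsep I {t | I.subtype.rTensor M t = 0} ?_
    intro t ht
    obtain ⟨u, hu, hu0⟩ := exists_rTensor_eq_of_rTensor_eq_zero (M := M) (x := x)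
      I.subtype (x • LinearMap.id) I.subtype (by ext; rfl)
      (by
        ext y
        simp only [LinearMap.mem_range, Submodule.mem_comap, Submodule.mem_smul_pointwise_iff_exists]
        constructor
        · rintro ⟨z, rfl⟩
          exact ⟨z, trivial, rfl⟩
        · rintro ⟨z, -, hz⟩
          have hzI : z ∈ I := by
            rw [heq]
            change x • z ∈ I
            rw [hz]
            exact y.2
          exact ⟨⟨z, hzI⟩, Subtype.ext hz⟩)
      hxA ht
    refine ⟨u, hu0, ?_⟩
    rw [← hu, LinearMap.rTensor_smul, LinearMap.rTensor_id]; rfl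

lemma IsTensorSeparated.quotSMulTop {A : Type u} {M : Type*} [CommRing A] [AddCommGroup M]
    [Module A M] (x : A) {y : A} (h : IsTensorSeparated A M y) :
    IsTensorSeparated (A ⧸ Ideal.span {x}) (QuotSMulTop x M) (Ideal.Quotient.mk _ y) := by
  intro N _ _ _ S hS t ht
  let R := A ⧸ Ideal.span {x}
  let := Module.compHom N (algebraMap A R)
  have : IsScalarTower A R N := IsScalarTower.of_compHom A R N
  have : Module.Finite A N := Module.Finite.trans R N
  let e₀ : QuotSMulTop x M ≃ₗ[R] R ⊗[A] M :=
    (QuotSMulTop.equivQuotTensor x M).extendScalarsOfSurjective Ideal.Quotient.mk_surjective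
  let e : N ⊗[R] QuotSMulTop x M ≃ₗ[R] N ⊗[A] M :=
    (LinearEquiv.lTensor N e₀) ≪≫ₗ AlgebraTensorModule.cancelBaseChange A R R N M
  have key := h N (e '' S) ?_ (e t) ⟨t, ht, rfl⟩
  · simpa using key
  · rintro _ ⟨s, hs, rfl⟩
    obtain ⟨u, hu, rfl⟩ := hS s hs
    refine ⟨e u, ⟨u, hu, rfl⟩, ?_⟩
    rw [map_smul]
    exact (algebraMap_smul R y (e u)).symm

lemma Module.Flat.of_isWeaklyRegular_of_isMaximal {A : Type u} {M : Type*} [CommRing A]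
    [IsNoetherianRing A] [AddCommGroup M] [Module A M] {rs : List A} (hrs : IsWeaklyRegular M rs)
    (hmax : (Ideal.ofList rs).IsMaximal) (hsep : ∀ x ∈ rs, IsTensorSeparated A M x) :
    Module.Flat A M := by
  induction hn : rs.length generalizing A M with
  | zero =>
    obtain rfl := List.length_eq_zero_iff.1 hn
    rw [Ideal.ofList_nil] at hmax
    have := Ideal.Quotient.nontrivial_iff.2 hmax.ne_top
    have := (Ideal.Quotient.mk (⊥ : Ideal A)).domain_nontrivial
    let := (Ring.isField_iff_maximal_bot.2 hmax).toField
    infer_instance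
  | succ n ih =>
    obtain ⟨x, rs, rfl⟩ := List.exists_cons_of_length_eq_add_one hn
    obtain ⟨hx, hrs'⟩ := (isWeaklyRegular_cons_iff' M x rs).1 hrs
    have hmap : Ideal.ofList (rs.map (Ideal.Quotient.mk (Ideal.span {x}))) =
        (Ideal.ofList (x :: rs)).map (Ideal.Quotient.mk (Ideal.span {x})) := by
      rw [Ideal.map_ofList, List.map_cons, Ideal.ofList_cons, Ideal.Quotient.mk_singleton_self]
      simp
    have hflat := ih hrs' (by
        rw [hmap]
        refine Ideal.IsMaximal.map_of_surjective_of_ker_le Ideal.Quotient.mk_surjective ?_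
        rw [Ideal.mk_ker, Ideal.ofList_cons]
        exact le_sup_left) (by
        intro y hy
        obtain ⟨y, hy', rfl⟩ := List.mem_map.1 hy
        exact (hsep y (List.mem_cons_of_mem _ hy')).quotSMulTop x) (by simpa using hn)
    let e : QuotSMulTop x M ≃ₗ[A ⧸ Ideal.span {x}] (A ⧸ Ideal.span {x}) ⊗[A] M :=
      (QuotSMulTop.equivQuotTensor x M).extendScalarsOfSurjective Ideal.Quotient.mk_surjective
    have := Module.Flat.of_linearEquiv e.symm
    exact Module.Flat.of_isSMulRegular_of_flat_quotient hx (hsep x List.mem_cons_self)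

lemma IsTensorSeparated.of_finite {A : Type u} {B M : Type*} [CommRing A] [CommRing B]
    [IsNoetherianRing B] [Algebra A B] [AddCommGroup M] [Module A M] [Module B M]
    [IsScalarTower A B M] [Module.Finite B M] {x : A}
    (hx : algebraMap A B x ∈ (⊥ : Ideal B).jacobson) : IsTensorSeparated A M x := by
  intro N _ _ _ S hS t ht
  let e := AlgebraTensorModule.cancelBaseChange A B B M N
  have : Module.Finite B (M ⊗[A] N) := Module.Finite.equiv e
  let c := TensorProduct.comm A N M
  have hbot : Submodule.span B (c '' S) = ⊥ := by
    refine Submodule.eq_bot_of_le_smul_of_le_jacobson_bot (Ideal.span {algebraMap A B x}) _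
      (IsNoetherian.noetherian _) ?_ ((Ideal.span_singleton_le_iff_mem _).2 hx)
    rw [Submodule.span_le]
    rintro _ ⟨s, hs, rfl⟩
    obtain ⟨u, hu, rfl⟩ := hS s hs
    rw [map_smul, ← algebraMap_smul B x (c u)]
    exact Submodule.smul_mem_smul (Ideal.mem_span_singleton_self _)
      (Submodule.subset_span ⟨u, hu, rfl⟩)
  have h0 : c t ∈ Submodule.span B (c '' S) := Submodule.subset_span ⟨t, ht, rfl⟩
  rw [hbot, Submodule.mem_bot] at h0
  simpa using h0

end Flatness

section Depth

variable {B M : Type*} [CommRing B] [IsLocalRing B] [IsNoetherianRing B] [AddCommGroup M]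
  [Module B M] [Module.Finite B M]

lemma IsLocalRing.exists_isSMulRegular_iff_forall_eq_zero :
    (∃ z ∈ maximalIdeal B, IsSMulRegular M z) ↔
      ∀ v : M, (∀ a ∈ maximalIdeal B, a • v = 0) → v = 0 := by
  constructor
  · rintro ⟨z, hz, hzM⟩ v hv
    exact hzM (by simpa using hv z hz)
  · intro h
    have : Subsingleton (B ⧸ maximalIdeal B →ₗ[B] M) := by
      refine subsingleton_of_forall_eq 0 fun f ↦ ?_
      have h1 : f 1 = 0 := h _ fun a ha ↦ by
        rw [← map_smul, ← map_zero f]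
        congr 1
        rw [Algebra.smul_def, mul_one]
        exact Ideal.Quotient.eq_zero_iff_mem.2 ha
      apply LinearMap.ext
      intro b
      obtain ⟨b, rfl⟩ := Ideal.Quotient.mk_surjective b
      have : Ideal.Quotient.mk (maximalIdeal B) b = b • 1 := by
        rw [Algebra.smul_def, mul_one]; rfl
      rw [this, map_smul, h1, smul_zero, LinearMap.zero_apply]
    obtain ⟨r, hr, hrM⟩ := IsSMulRegular.subsingleton_linearMap_iff.1 this
    exact ⟨r, by simpa [Ideal.annihilator_quotient] using hr, hrM⟩

open Pointwise in
lemma forall_mem_smul_top_of_isSMulRegular {R N : Type*} [CommRing R] [AddCommGroup N] [Module R N]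
    {I : Ideal R} {x y : R} (hy : y ∈ I) (hxN : IsSMulRegular N x) (hyN : IsSMulRegular N y)
    (h : ∀ v : QuotSMulTop y N, (∀ a ∈ I, a • v = 0) → v = 0) (v : QuotSMulTop x N)
    (hv : ∀ a ∈ I, a • v = 0) : v = 0 := by
  obtain ⟨m, rfl⟩ := Submodule.Quotient.mk_surjective _ v
  have hm : ∀ a ∈ I, ∃ n, x • n = a • m := fun a ha ↦ by
    have := hv a ha
    rw [← Submodule.Quotient.mk_smul, Submodule.Quotient.mk_eq_zero,
      Submodule.mem_smul_pointwise_iff_exists] at this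
    obtain ⟨n, -, hn⟩ := this
    exact ⟨n, hn⟩
  obtain ⟨m', hm'⟩ := hm y hy
  have h0 : (Submodule.Quotient.mk m' : QuotSMulTop y N) = 0 := h _ fun a ha ↦ by
    obtain ⟨n, hn⟩ := hm a ha
    rw [← Submodule.Quotient.mk_smul, Submodule.Quotient.mk_eq_zero,
      Submodule.mem_smul_pointwise_iff_exists]
    refine ⟨n, trivial, hxN ?_⟩
    dsimp only
    rw [smul_comm x y n, hn, smul_comm x a m', hm', smul_comm]
  rw [Submodule.Quotient.mk_eq_zero, Submodule.mem_smul_pointwise_iff_exists] at h0 ⊢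
  obtain ⟨n, -, hn⟩ := h0
  refine ⟨n, trivial, hyN ?_⟩
  dsimp only
  rw [smul_comm y x n, hn, hm']

lemma RingTheory.Sequence.IsRegular.exists_quotSMulTop {n : ℕ} {x : B} (hx : x ∈ maximalIdeal B)
    (hxM : IsSMulRegular M x) {rs : List B} (h : IsRegular M rs) (hn : rs.length = n + 1)
    (hmem : ∀ r ∈ rs, r ∈ maximalIdeal B) :
    ∃ ws : List B, ws.length = n ∧ (∀ w ∈ ws, w ∈ maximalIdeal B) ∧
      IsRegular (QuotSMulTop x M) ws := by
  induction n generalizing x M rs with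
  | zero =>
    have := h.nontrivial
    have := nontrivial_quotSMulTop_of_mem_maximalIdeal M hx
    exact ⟨[], rfl, by simp, .nil _ _⟩
  | succ n ih =>
    obtain ⟨y, rs, rfl⟩ := List.exists_cons_of_length_eq_add_one hn
    obtain ⟨y', rs, rfl⟩ := List.exists_cons_of_length_eq_add_one (Nat.succ_injective hn)
    obtain ⟨hyM, hrs⟩ := (isRegular_cons_iff M y _).1 h
    have hy := hmem y List.mem_cons_self
    have hsocy := (exists_isSMulRegular_iff_forall_eq_zero (M := QuotSMulTop y M)).1
      ⟨y', hmem y' (by simp), ((isRegular_cons_iff _ _ _).1 hrs).1⟩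
    have hsocx := forall_mem_smul_top_of_isSMulRegular hy hxM hyM hsocy
    obtain ⟨z, hz, hzxy⟩ := (exists_isSMulRegular_iff_forall_eq_zero
      (M := QuotSMulTop x M × QuotSMulTop y M)).2 fun v hv ↦
        Prod.ext (hsocx _ fun a ha ↦ congrArg Prod.fst (hv a ha))
          (hsocy _ fun a ha ↦ congrArg Prod.snd (hv a ha))
    have hzx : IsSMulRegular (QuotSMulTop x M) z := fun a b hab ↦ congrArg Prod.fst
      (hzxy (a₁ := (a, 0)) (a₂ := (b, 0)) (Prod.ext hab rfl))
    have hzy : IsSMulRegular (QuotSMulTop y M) z := fun a b hab ↦ congrArg Prod.snd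
      (hzxy (a₁ := (0, a)) (a₂ := (0, b)) (Prod.ext rfl hab))
    obtain ⟨ws, hwn, hwm, hws⟩ := ih hz hzy hrs (Nat.succ_injective hn)
      fun r hr ↦ hmem r (List.mem_cons_of_mem _ hr)
    have h1 : IsRegular M (z :: y :: ws) :=
      isRegular_of_perm (.cons hyM (.cons hzy hws)) (List.Perm.swap _ _ _)
    obtain ⟨hzM, h2⟩ := (isRegular_cons_iff M z _).1 h1
    have hxz : IsSMulRegular (QuotSMulTop z M) x := by
      have h3 : IsWeaklyRegular M [x, z] := .cons hxM (.cons hzx (.nil _ _))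
      have h4 := isWeaklyRegular_of_perm_of_subset_maximalIdeal h3 (List.Perm.swap z x [])
        (by rintro r hr; rcases List.mem_pair.1 hr with rfl | rfl <;> assumption)
      exact ((isWeaklyRegular_cons_iff _ _ _).1 ((isWeaklyRegular_cons_iff _ _ _).1 h4).2).1
    obtain ⟨vs, hvn, hvm, hvs⟩ := ih hx hxz h2 (by simpa using hwn)
      (by simpa using ⟨hy, hwm⟩)
    have h5 : IsRegular M (x :: z :: vs) :=
      isRegular_of_perm (.cons hzM (.cons hxz hvs)) (List.Perm.swap _ _ _)
    exact ⟨z :: vs, by simpa using hvn, by simpa using ⟨hz, hvm⟩,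
      ((isRegular_cons_iff _ _ _).1 h5).2⟩

end Depth

section Dimension

variable {B M : Type*} [CommRing B] [IsLocalRing B] [IsNoetherianRing B] [AddCommGroup M]
  [Module B M] [Module.Finite B M]

open Pointwise in
lemma IsAssociatedPrime.exists_quotSMulTop {p : Ideal B} (hp : IsAssociatedPrime p M) {y : B}
    (hy : y ∈ maximalIdeal B) (hyM : IsSMulRegular M y) :
    ∃ q : Ideal B, IsAssociatedPrime q (QuotSMulTop y M) ∧ p ≤ q ∧ y ∈ q := by
  obtain ⟨hpp, m, rfl⟩ := isAssociatedPrime_iff.1 hp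
  set p := (⊥ : Submodule B M).colon {m} with hpdef
  set N := Submodule.torsionBySet B M (p : Set B) with hN
  have hmN : m ∈ N := by
    rw [hN, Submodule.mem_torsionBySet_iff]
    rintro ⟨a, ha⟩
    simpa [hpdef, Submodule.mem_colon_singleton] using ha
  have hm0 : m ≠ 0 := by
    rintro rfl
    exact hpp.ne_top (by simp [hpdef])
  obtain ⟨v, hvN, hv⟩ : ∃ v ∈ N, (Submodule.Quotient.mk v : QuotSMulTop y M) ≠ 0 := by
    by_contra! h
    have hNbot : N = ⊥ := by
      refine Submodule.eq_bot_of_le_smul_of_le_jacobson_bot (Ideal.span {y}) N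
        (IsNoetherian.noetherian N) (fun v hv ↦ ?_) ?_
      · have h1 := h v hv
        rw [Submodule.Quotient.mk_eq_zero, Submodule.mem_smul_pointwise_iff_exists] at h1
        obtain ⟨w, -, rfl⟩ := h1
        refine Submodule.smul_mem_smul (Ideal.mem_span_singleton_self y) ?_
        rw [hN, Submodule.mem_torsionBySet_iff] at hv ⊢
        intro a
        refine hyM ?_
        dsimp only
        rw [smul_zero, smul_comm]
        exact hv a
      · rw [jacobson_eq_maximalIdeal _ bot_ne_top, Ideal.span_singleton_le_iff_mem]
        exact hy
    rw [hNbot, Submodule.mem_bot] at hmN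
    exact hm0 hmN
  obtain ⟨q, hq, hle⟩ := exists_le_isAssociatedPrime_of_isNoetherianRing B _ hv
  refine ⟨q, hq, fun a ha ↦ hle ?_, hle ?_⟩
  · rw [Submodule.mem_colon_singleton, Submodule.mem_bot, ← Submodule.Quotient.mk_smul,
      (Submodule.mem_torsionBySet_iff _ _).1 hvN ⟨a, ha⟩, Submodule.Quotient.mk_zero]
  · rw [Submodule.mem_colon_singleton, Submodule.mem_bot, ← Submodule.Quotient.mk_smul,
      Submodule.Quotient.mk_eq_zero]
    exact Submodule.smul_mem_pointwise_smul _ _ _ trivial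

lemma RingTheory.Sequence.IsRegular.length_le_ringKrullDim_quotient {rs : List B}
    (h : IsRegular M rs) (hmem : ∀ r ∈ rs, r ∈ maximalIdeal B) {p : Ideal B}
    (hp : IsAssociatedPrime p M) : (rs.length : WithBot ℕ∞) ≤ ringKrullDim (B ⧸ p) := by
  induction rs generalizing M p with
  | nil =>
    have := hp.1
    simpa using ringKrullDim_nonneg_of_nontrivial (R := B ⧸ p)
  | cons y rs ih =>
    obtain ⟨hyM, hrs⟩ := (isRegular_cons_iff M y _).1 h
    obtain ⟨q, hq, hpq, hyq⟩ := hp.exists_quotSMulTop (hmem y List.mem_cons_self) hyM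
    have hyp : y ∉ p := fun hy ↦ by
      have : y ∈ {r : B | IsSMulRegular M r}ᶜ := by
        rw [← biUnion_associatedPrimes_eq_compl_regular B M]
        exact Set.mem_biUnion (show p ∈ associatedPrimes B M from hp) hy
      exact this hyM
    have := hp.1
    have h1 := ringKrullDim_succ_le_of_surjective (Ideal.Quotient.factor hpq)
      (Ideal.Quotient.factor_surjective hpq) (r := Ideal.Quotient.mk p y)
      (mem_nonZeroDivisors_of_ne_zero (by rwa [Ne, Ideal.Quotient.eq_zero_iff_mem]))
      (by simpa [Ideal.Quotient.eq_zero_iff_mem] using hyq)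
    refine le_trans ?_ h1
    rw [List.length_cons, Nat.cast_add, Nat.cast_one]
    gcongr
    exact ih hrs (fun r hr ↦ hmem r (List.mem_cons_of_mem _ hr)) hq

lemma Module.supportDim_le_supportDim_quotient_ofList_add_length {rs : List B}
    (hmem : ∀ r ∈ rs, r ∈ maximalIdeal B) :
    Module.supportDim B M ≤
      Module.supportDim B (M ⧸ Ideal.ofList rs • (⊤ : Submodule B M)) + rs.length := by
  induction rs generalizing M with
  | nil =>
    rw [List.length_nil, Nat.cast_zero, add_zero, Ideal.ofList_nil, Submodule.bot_smul]
    exact (Module.supportDim_eq_of_equiv (Submodule.quotEquivOfEqBot _ rfl)).ge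
  | cons x rs ih =>
    refine (Module.supportDim_le_supportDim_quotSMulTop_succ
      (hmem x List.mem_cons_self)).trans ?_
    rw [Module.supportDim_eq_of_equiv
      (Submodule.quotOfListConsSMulTopEquivQuotSMulTopInner M x rs), List.length_cons,
      Nat.cast_add, Nat.cast_one, ← add_assoc]
    gcongr
    exact ih (fun r hr ↦ hmem r (List.mem_cons_of_mem _ hr))

lemma Module.supportDim_le_of_support_subset {R N N' : Type*} [CommRing R] [AddCommGroup N]
    [Module R N] [AddCommGroup N'] [Module R N'] (h : Module.support R N ⊆ Module.support R N') :
    Module.supportDim R N ≤ Module.supportDim R N' :=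
  Order.krullDim_le_of_strictMono (Set.inclusion h) fun _ _ hab ↦ hab

end Dimension

section SystemOfParameters

variable {B M : Type*} [CommRing B] [IsLocalRing B] [IsNoetherianRing B] [AddCommGroup M]
  [Module B M] [Module.Finite B M]

lemma IsAssociatedPrime.ringKrullDim_quotient_le {p : Ideal B} (hp : IsAssociatedPrime p M)
    {x : B} (hxp : x ∈ p) {rs : List B} (hmem : ∀ r ∈ rs, r ∈ maximalIdeal B) :
    ringKrullDim (B ⧸ p) ≤
      Module.supportDim B (M ⧸ Ideal.ofList (x :: rs) • (⊤ : Submodule B M)) + rs.length := by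
  rw [← Module.supportDim_quotient_eq_ringKrullDim]
  refine (Module.supportDim_le_supportDim_quotient_ofList_add_length hmem).trans ?_
  gcongr
  refine Module.supportDim_le_of_support_subset ?_
  rw [Module.support_quotient, Module.support_quotient, Module.support_eq_zeroLocus (M := B ⧸ p),
    Ideal.annihilator_quotient]
  rintro q ⟨hpq, hq⟩
  refine ⟨Module.mem_support_mono (p := ⟨p, hp.1⟩) hpq ?_, ?_⟩
  · rw [Module.mem_support_iff_of_finite]
    exact Submodule.annihilator_top.symm.trans_le hp.annihilator_le
  · rw [Ideal.ofList_cons, PrimeSpectrum.mem_zeroLocus, SetLike.coe_subset_coe]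
    refine sup_le ?_ hq
    rw [Ideal.span_singleton_le_iff_mem]
    exact hpq hxp

lemma RingTheory.Sequence.IsWeaklyRegular.of_supportDim_quotient_add_length_le {n : ℕ}
    {rs : List B} (hmem : ∀ r ∈ rs, r ∈ maximalIdeal B) {ys : List B} (hys : IsRegular M ys)
    (hymem : ∀ y ∈ ys, y ∈ maximalIdeal B) (hn : ys.length = n)
    (hdim : Module.supportDim B (M ⧸ Ideal.ofList rs • (⊤ : Submodule B M)) + rs.length ≤ n) :
    IsWeaklyRegular M rs := by
  induction rs generalizing M n ys with
  | nil => exact .nil _ _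
  | cons x rs ih =>
    have hx := hmem x List.mem_cons_self
    have hrs : ∀ r ∈ rs, r ∈ maximalIdeal B := fun r hr ↦ hmem r (List.mem_cons_of_mem _ hr)
    have := hys.nontrivial
    have hnt : Nontrivial (M ⧸ Ideal.ofList (x :: rs) • (⊤ : Submodule B M)) := by
      rw [Submodule.Quotient.nontrivial_iff]
      refine (Submodule.top_ne_ideal_smul_of_le_jacobson_annihilator ?_).symm
      refine le_trans ?_ (maximalIdeal_le_jacobson _)
      exact Ideal.span_le.2 hmem
    have hne := Module.supportDim_ne_bot_of_nontrivial B
      (M ⧸ Ideal.ofList (x :: rs) • (⊤ : Submodule B M))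
    rw [List.length_cons] at hdim
    obtain ⟨d, hd⟩ := WithBot.ne_bot_iff_exists.1 hne
    have hxM : IsSMulRegular M x := by
      by_contra hxM
      have h1 : x ∈ {r : B | IsSMulRegular M r}ᶜ := hxM
      rw [← biUnion_associatedPrimes_eq_compl_regular B M, Set.mem_iUnion₂] at h1
      obtain ⟨p, hp, hxp⟩ := h1
      have h2 := (hys.length_le_ringKrullDim_quotient hymem hp).trans
        (IsAssociatedPrime.ringKrullDim_quotient_le hp hxp hrs)
      rw [hn] at h2
      have h3 := hdim.trans h2
      rw [← hd] at h3 hdim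
      norm_cast at h3 hdim
      have hdt : d ≠ ⊤ := by rintro rfl; simp at hdim
      lift d to ℕ using hdt
      norm_cast at h3
      omega
    obtain ⟨m, rfl⟩ : ∃ m, n = m + 1 := by
      refine Nat.exists_eq_succ_of_ne_zero ?_
      rintro rfl
      rw [← hd] at hdim
      norm_cast at hdim
      simp at hdim
    obtain ⟨ws, hwn, hwm, hws⟩ := hys.exists_quotSMulTop hx hxM hn hymem
    refine .cons hxM (ih hrs hws hwm hwn ?_)
    rw [← Module.supportDim_eq_of_equiv
      (Submodule.quotOfListConsSMulTopEquivQuotSMulTopInner M x rs), ← hd]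
    rw [← hd] at hdim
    norm_cast at hdim ⊢
    have hdt : d ≠ ⊤ := by rintro rfl; simp at hdim
    lift d to ℕ using hdt
    norm_cast at hdim ⊢
    omega

end SystemOfParameters

lemma IsMaximalCohenMacaulay.exists_isRegular {B M : Type*} [CommRing B] [IsLocalRing B]
    [IsNoetherianRing B] [AddCommGroup M] [Module B M] [Nontrivial M]
    (h : IsMaximalCohenMacaulay B M) :
    ∃ ys : List B, (ys.length : WithBot ℕ∞) = ringKrullDim B ∧
      (∀ y ∈ ys, y ∈ maximalIdeal B) ∧ IsRegular M ys := by
  have hlt : moduleDepth B M < ⊤ := by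
    have hdim := ringKrullDim_lt_top (R := B)
    rw [← h, ← WithBot.coe_top] at hdim
    exact WithBot.coe_lt_coe.1 hdim
  have : Nonempty {n : ℕ∞ | ∃ rs : List B, (rs.length : ℕ∞) = n ∧
      (∀ y ∈ rs, y ∈ maximalIdeal B) ∧ IsRegular M rs} :=
    ⟨0, [], by simp, by simp, .nil _ _⟩
  obtain ⟨ys, hlen, hmem, hreg⟩ := ENat.sSup_mem_of_nonempty_of_lt_top hlt
  exact ⟨ys, by rw [← h, moduleDepth, ← hlen]; rfl, hmem, hreg⟩

lemma ringKrullDim_add_ringKrullDim_quotient_map_maximalIdeal (A B : Type*) [CommRing A]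
    [CommRing B] [IsLocalRing A] [IsLocalRing B] [IsNoetherianRing A] [IsNoetherianRing B]
    [Algebra A B] [IsLocalHom (algebraMap A B)] [Module.Flat A B] :
    ringKrullDim A + ringKrullDim (B ⧸ (maximalIdeal A).map (algebraMap A B)) =
      ringKrullDim B := by
  set I := (maximalIdeal A).map (algebraMap A B)
  have hI : I ≤ maximalIdeal B := ((local_hom_TFAE (algebraMap A B)).out 0 2).1 ‹_›
  have hne : I ≠ ⊤ := ne_top_of_le_ne_top (Ideal.IsPrime.ne_top inferInstance) hI
  have : Nontrivial (B ⧸ I) := Ideal.Quotient.nontrivial_iff.mpr hne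
  have := IsLocalRing.of_surjective' (Ideal.Quotient.mk I) Ideal.Quotient.mk_surjective
  have := IsLocalHom.of_surjective (Ideal.Quotient.mk I) Ideal.Quotient.mk_surjective
  have hmap : (maximalIdeal B).map (Ideal.Quotient.mk I) = maximalIdeal (B ⧸ I) := by
    ext x
    obtain ⟨x, rfl⟩ := Ideal.Quotient.mk_surjective x
    simp [sup_eq_left.mpr hI]
  have h := Ideal.height_eq_height_add_of_liesOver_of_hasGoingDown (maximalIdeal A)
    (maximalIdeal B)
  rw [← maximalIdeal_height_eq_ringKrullDim, ← maximalIdeal_height_eq_ringKrullDim,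
    ← maximalIdeal_height_eq_ringKrullDim, h, ← hmap]
  rfl

/-- Let `(A, 𝔪_A)` be a regular local ring, `(B, 𝔪_B)` a Noetherian
Cohen–Macaulay local ring, and `A → B` a flat local ring homomorphism.  Any
nonzero finitely generated maximal Cohen–Macaulay `B`-module is flat over `A`. -/
theorem flat_of_maximalCohenMacaulay
    {A B M : Type*} [CommRing A] [CommRing B] [IsLocalRing A] [IsLocalRing B]
    [IsNoetherianRing A] [IsNoetherianRing B]
    [AddCommGroup M] [Module B M]
    [Algebra A B] [IsLocalHom (algebraMap A B)] [Module.Flat A B]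
    [Module A M] [IsScalarTower A B M]
    (hA : IsRegularLocal A) (hB : IsCohenMacaulayLocal B)
    (hfin : Module.Finite B M) (hM0 : Nontrivial M)
    (hMCM : IsMaximalCohenMacaulay B M) :
    Module.Flat A M := by
  obtain ⟨s, hs, hcard⟩ := hA
  have hofList : Ideal.ofList s.toList = maximalIdeal A := by simpa [Ideal.ofList] using hs
  have hsmem : ∀ x ∈ s.toList, algebraMap A B x ∈ maximalIdeal B := fun x hx ↦ by
    have hle : maximalIdeal A ≤ (maximalIdeal B).comap (algebraMap A B) :=
      ((local_hom_TFAE (algebraMap A B)).out 0 3).1 ‹_›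
    refine hle ?_
    rw [← hofList]
    exact Ideal.subset_span hx
  obtain ⟨ys, hlen, hymem, hys⟩ := hMCM.exists_isRegular
  refine Module.Flat.of_isWeaklyRegular_of_isMaximal (rs := s.toList) ?_
    (hofList ▸ maximalIdeal.isMaximal A) fun x hx ↦ IsTensorSeparated.of_finite (B := B) ?_
  · rw [← isWeaklyRegular_map_algebraMap_iff B M]
    refine .of_supportDim_quotient_add_length_le (by simpa using hsmem) hys hymem rfl ?_
    rw [hlen, ← ringKrullDim_add_ringKrullDim_quotient_map_maximalIdeal A B, ← hcard,
      List.length_map, Finset.length_toList, add_comm, ← hofList, Ideal.map_ofList,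
      ← Module.supportDim_quotient_eq_ringKrullDim]
    gcongr
    · rfl
    refine Module.supportDim_le_of_support_subset ?_
    rw [Module.support_quotient, Module.support_eq_zeroLocus (M := B ⧸ Ideal.ofList _),
      Ideal.annihilator_quotient]
    exact Set.inter_subset_right
  · rw [jacobson_eq_maximalIdeal _ bot_ne_top]
    exact hsmem x hx
end

section
/- In the formal power series ring ℚ[[U]] the following identity holds: U²·exp(U) − (exp(U) − 1)² = −U²·(exp(U) − 1)²·∑_{d=0}^{∞} (B_{d+2} / ((d+2)·d!))·U^d. (Equivalently, the function e^U/(e^U − 1)² − 1/U² has power series expansion ∑_{d≥0} (−B_{d+2}/((d+2)·d!))·U^d at U = 0; this is the identity expressing the negative zeta value regularization ∑_{k≥1} k^{d+1} := −B_{d+2}/(d+2) of the series ∑_{k≥1} k e^{kU}.) -/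
open PowerSeries

/-- Writing `B` for the exponential generating series of the Bernoulli numbers,
`U²·∑_{d≥0} (B_{d+2}/((d+2)·d!))·U^d = U·B' - B + 1`. -/
theorem X_sq_mul_mk_bernoulli_add_two :
    (X : PowerSeries ℚ) ^ 2 * PowerSeries.mk (fun d => bernoulli (d + 2) /
        (((d : ℚ) + 2) * (Nat.factorial d : ℚ))) =
      X * derivative ℚ (bernoulliPowerSeries ℚ) - bernoulliPowerSeries ℚ + 1 := by
  ext n
  rcases n with _ | _ | d
  · simp [bernoulliPowerSeries, coeff_X_pow_mul']
  · simp [bernoulliPowerSeries, coeff_X_pow_mul', coeff_succ_X_mul, coeff_derivative, coeff_one]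
  · rw [show d + 1 + 1 = d + 2 from rfl, coeff_X_pow_mul, map_add, map_sub, coeff_succ_X_mul,
      coeff_derivative]
    simp only [bernoulliPowerSeries, coeff_mk, coeff_one, Nat.factorial_succ,
      Algebra.algebraMap_self, RingHom.id_apply]
    push_cast
    field_simp
    ring

/-- In `ℚ⟦U⟧`:
`U²·exp(U) − (exp(U) − 1)² = −U²·(exp(U) − 1)²·∑_{d≥0} (B_{d+2}/((d+2)·d!))·U^d`,
i.e. `e^U/(e^U−1)² − 1/U²` has power series `∑_{d≥0} (−B_{d+2}/((d+2)·d!))·U^d`. -/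
theorem powerSeries_exp_bernoulli_identity :
    (X : PowerSeries ℚ) ^ 2 * exp ℚ - (exp ℚ - 1) ^ 2 =
      -X ^ 2 * (exp ℚ - 1) ^ 2 *
        PowerSeries.mk (fun d => bernoulli (d + 2) /
          (((d : ℚ) + 2) * (Nat.factorial d : ℚ))) := by
  have hB := bernoulliPowerSeries_mul_exp_sub_one ℚ
  have hB' := congrArg (derivative ℚ) hB
  simp only [Derivation.leibniz, map_sub, derivative_exp, derivative_one, derivative_X, sub_zero,
    smul_eq_mul] at hB'
  linear_combination (exp ℚ - 1) ^ 2 * X_sq_mul_mk_bernoulli_add_two +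
    X * (exp ℚ - 1) * hB' - (exp ℚ - 1 + X * exp ℚ) * hB
end
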